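/- Let G be an acyclic simple graph, let A = {a₁,…,aₙ} (n ≥ 2) be a finite set of vertices, and let b be a vertex with dist(b,a_i) = k_i for every i = 1,…,n (so all these distances are finite). Let c be the unique vertex of conv(A) closest to b, set d_{ij} = dist(a_i,a_j), ℓ_{ij} = (k_i + k_j − d_{ij})/2, and ℓ = min{ℓ_{ij} : 1 ≤ i < j ≤ n} = dist(b, conv(A)). If the number m of neighbors of c lying in conv(A) satisfies m ≥ 2, then there exist indices s₁,…,s_m ∈ {1,…,n} such that: (i) ℓ_{s_i, s_j} = ℓ whenever 1 ≤ i < j ≤ m; and (ii) for every index t ∉ {s₁,…,s_m} with a_t ≠ c, there exist indices s₁ᵗ, s₂ᵗ ∈ {s₁,…,s_m} such that exactly one of the two equalities ℓ_{t, s₁ᵗ} = ℓ and ℓ_{t, s₂ᵗ} = ℓ holds. -/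

import Mathlib

namespace InfiniteBranchingTree

/-- The convex closure of a set `A` of vertices of a graph `G`: `A` together with all
vertices lying on a path between two elements of `A`. -/
def convClosure {V : Type*} (G : SimpleGraph V) (A : Set V) : Set V :=
  A ∪ {v | ∃ a ∈ A, ∃ a' ∈ A, ∃ p : G.Walk a a', p.IsPath ∧ v ∈ p.support}

open SimpleGraph

/-- `v` is a neighbor of `c` on a geodesic from `c` to `x`. -/
def IsFirstStep {V : Type*} (G : SimpleGraph V) (c v x : V) : Prop :=
  G.Adj c v ∧ G.dist c x = G.dist v x + 1

section

variable {V : Type*} {G : SimpleGraph V}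

theorem exists_isFirstStep {c x : V} (h : G.Reachable c x) (hne : c ≠ x) :
    ∃ v, IsFirstStep G c v x := by
  obtain ⟨p, hp⟩ := h.exists_walk_length_eq_dist
  cases p with
  | nil => exact absurd rfl hne
  | @cons _ v _ hadj q =>
    refine ⟨v, hadj, ?_⟩
    rw [Walk.length_cons] at hp
    have h₁ := dist_le q
    have h₂ := hadj.reachable.dist_triangle_left x
    rw [dist_eq_one_iff_adj.mpr hadj] at h₂
    omega

theorem isPath_length_eq_dist (hG : G.IsAcyclic) {x y : V} {p : G.Walk x y} (hp : p.IsPath) :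
    p.length = G.dist x y := by
  obtain ⟨q, hq, hlen⟩ := p.reachable.exists_path_of_dist
  have := congrArg (fun r : G.Path x y ↦ r.1.length)
    ((hG.subsingleton_path x y).elim ⟨p, hp⟩ ⟨q, hq⟩)
  exact this.trans hlen

theorem IsFirstStep.dist_add_dist_of_ne (hG : G.IsAcyclic) {c v w x y : V}
    (hv : IsFirstStep G c v x) (hw : IsFirstStep G c w y) (hne : v ≠ w)
    (hx : G.Reachable c x) (hy : G.Reachable c y) :
    G.dist x y = G.dist c x + G.dist c y := by
  have geodesic {u z : V} (hu : IsFirstStep G c u z) (hz : G.Reachable c z) :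
      ∃ p : G.Walk u z, (Walk.cons hu.1 p).IsPath ∧ (Walk.cons hu.1 p).length = G.dist c z := by
    obtain ⟨p, hp⟩ := (hu.1.symm.reachable.trans hz).exists_walk_length_eq_dist
    have hlen : (Walk.cons hu.1 p).length = G.dist c z := by
      rw [Walk.length_cons, hp, hu.2]
    exact ⟨p, Walk.isPath_of_length_eq_dist _ hlen, hlen⟩
  obtain ⟨p, hp, hpl⟩ := geodesic hv hx
  obtain ⟨q, hq, hql⟩ := geodesic hw hy
  have hpath : ((Walk.cons hv.1 p).reverse.append (Walk.cons hw.1 q)).IsPath := by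
    have h₁ := (hG.isPath_iff_isChain _).mp hp.reverse
    have h₂ := (hG.isPath_iff_isChain _).mp hq
    rw [hG.isPath_iff_isChain, Walk.edges_append, List.isChain_append]
    refine ⟨h₁, h₂, ?_⟩
    simpa [eq_comm] using ⟨fun h : c = v ↦ absurd h hv.1.ne, hne⟩
  rw [← isPath_length_eq_dist hG hpath, Walk.length_append, Walk.length_reverse, hpl, hql]

theorem IsFirstStep.dist_add_two_le {c v x y : V}
    (hx : IsFirstStep G c v x) (hy : IsFirstStep G c v y) (h : G.Reachable c x) :
    G.dist x y + 2 ≤ G.dist c x + G.dist c y := by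
  have := (hx.1.symm.reachable.trans h).symm.dist_triangle_left y
  rw [hx.2, hy.2, dist_comm (u := v) (v := x)]
  omega

theorem IsFirstStep.eq (hG : G.IsAcyclic) {c v w x : V} (hv : IsFirstStep G c v x)
    (hw : IsFirstStep G c w x) (h : G.Reachable c x) : v = w := by
  by_contra hne
  have h₁ := hv.dist_add_dist_of_ne hG hw hne h h
  have h₂ := hv.2
  rw [dist_self] at h₁
  omega

theorem mem_convClosure_iff (hG : G.IsAcyclic) {A : Set V} {x : V} :
    x ∈ convClosure G A ↔ ∃ a ∈ A, ∃ a' ∈ A, G.Reachable a x ∧ G.Reachable x a' ∧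
      G.dist a a' = G.dist a x + G.dist x a' := by
  classical
  constructor
  · rintro (hx | ⟨a, ha, a', ha', p, hp, hx⟩)
    · exact ⟨x, hx, x, hx, .rfl, .rfl, by simp⟩
    · refine ⟨a, ha, a', ha', (p.takeUntil x hx).reachable, (p.dropUntil x hx).reachable, ?_⟩
      rw [← isPath_length_eq_dist hG hp, ← isPath_length_eq_dist hG (hp.takeUntil hx),
        ← isPath_length_eq_dist hG (hp.dropUntil hx), ← Walk.length_append, Walk.take_spec]
  · rintro ⟨a, ha, a', ha', h₁, h₂, h⟩
    obtain ⟨p, hp⟩ := h₁.exists_walk_length_eq_dist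
    obtain ⟨q, hq⟩ := h₂.exists_walk_length_eq_dist
    refine Or.inr ⟨a, ha, a', ha', p.append q, Walk.isPath_of_length_eq_dist _ ?_, by simp⟩
    rw [Walk.length_append, hp, hq, h]

theorem IsFirstStep.mem_convClosure (hG : G.IsAcyclic) {A : Set V} {c v x : V}
    (hv : IsFirstStep G c v x) (hc : c ∈ convClosure G A) (hx : x ∈ A)
    (hcx : G.Reachable c x) : v ∈ convClosure G A := by
  have hvx := hv.1.symm.reachable.trans hcx
  have mem_of_dist {a : V} (ha : a ∈ A) (hca : G.Reachable c a)
      (h : G.dist a x = G.dist c a + G.dist c x) : v ∈ convClosure G A := by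
    refine (mem_convClosure_iff hG).mpr
      ⟨a, ha, x, hx, hca.symm.trans hv.1.reachable, hvx, ?_⟩
    have h₁ := hca.symm.dist_triangle_left v
    have h₂ := (hca.symm.trans hv.1.reachable).dist_triangle_left x
    rw [dist_eq_one_iff_adj.mpr hv.1, dist_comm (u := a) (v := c)] at h₁
    have := hv.2
    omega
  obtain ⟨a, ha, a', ha', hac, hca', h⟩ := (mem_convClosure_iff hG).mp hc
  by_cases hca : c = a
  · subst hca
    exact mem_of_dist ha .rfl (by simp)
  by_cases hne : c = a'
  · subst hne
    exact mem_of_dist ha' .rfl (by simp)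
  obtain ⟨w, hw⟩ := exists_isFirstStep hac.symm hca
  obtain ⟨w', hw'⟩ := exists_isFirstStep hca' hne
  by_cases hwv : w = v
  · by_cases hwv' : w' = v
    · subst hwv hwv'
      have := hw.dist_add_two_le hw' hac.symm
      rw [dist_comm (u := a) (v := c)] at h
      omega
    · exact mem_of_dist ha' hca' (hw'.dist_add_dist_of_ne hG hv hwv' hca' hcx)
  · exact mem_of_dist ha hac.symm (hw.dist_add_dist_of_ne hG hv hwv hac.symm hcx)

theorem exists_isFirstStep_of_mem_convClosure (hG : G.IsAcyclic) {A : Set V} {c v : V}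
    (hadj : G.Adj c v) (hv : v ∈ convClosure G A) :
    ∃ a ∈ A, IsFirstStep G c v a := by
  by_contra! hcon
  obtain ⟨a, ha, a', ha', hav, hva', h⟩ := (mem_convClosure_iff hG).mp hv
  have away {z : V} (hz : z ∈ A) (hzv : G.Reachable z v) : IsFirstStep G v c z := by
    refine ⟨hadj.symm, ?_⟩
    rcases hG.dist_eq_dist_add_one_of_adj_of_reachable z hadj.symm hzv with h | h
    · rwa [dist_comm, dist_comm (u := c)]
    · exact absurd ⟨hadj, by rwa [dist_comm, dist_comm (u := v)]⟩ (hcon z hz)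
  have := (away ha hav).dist_add_two_le (away ha' hva'.symm) hav.symm
  rw [dist_comm (u := a) (v := v)] at h
  omega

theorem dist_eq_dist_add_dist_of_nearest (hG : G.IsAcyclic) {A : Set V} {b c x : V}
    (hc : c ∈ convClosure G A) (hbc : G.Reachable b c)
    (hnear : ∀ y ∈ convClosure G A, G.Reachable b y → G.dist b c ≤ G.dist b y)
    (hx : x ∈ A) (hcx : G.Reachable c x) :
    G.dist b x = G.dist b c + G.dist c x := by
  by_cases hb : c = b
  · simp [hb]
  by_cases hne : c = x
  · simp [hne]
  obtain ⟨w, hw⟩ := exists_isFirstStep hbc.symm hb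
  obtain ⟨v, hv⟩ := exists_isFirstStep hcx hne
  have hwv : w ≠ v := by
    rintro rfl
    have h₁ := hnear w (hv.mem_convClosure hG hc hx hcx) (hbc.trans hw.1.reachable)
    have h₂ := hw.2
    rw [dist_comm (u := b) (v := c), dist_comm (u := b) (v := w)] at h₁
    omega
  rw [hw.dist_add_dist_of_ne hG hv hwv hbc.symm hcx, dist_comm (u := c) (v := b)]

end

/-- (Proposition `prop:notboth`.)  Let `G` be an acyclic simple graph,
`a₀, …, a_{n+1}` vertices, and `b` a vertex with `dist(b, a i) = k i` for all `i`.  Let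
`c` be the unique vertex of the convex closure `conv(A)` of `A = {a i}` closest to `b`,
let `ℓ i j = (k i + k j − dist(a i, a j))/2`, and let `ℓmin = min ℓ i j = dist(b, conv A)`.
If the number `m` of neighbors of `c` lying in `conv(A)` satisfies `m ≥ 2`, then there
are distinct indices `s 0, …, s (m-1)` such that (i) `ℓ (s i) (s j) = ℓmin` for `i < j`,
and (ii) for every index `t` outside the range of `s` with `a t ≠ c` there are indices
`s i`, `s j` such that exactly one of `ℓ t (s i) = ℓmin` and `ℓ t (s j) = ℓmin` holds. -/
theorem exactly_one_min_distance {V : Type*} (G : SimpleGraph V) (hG : G.IsAcyclic)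
    (n : ℕ) (a : Fin (n + 2) → V) (k : Fin (n + 2) → ℕ) (b : V)
    (hb : ∀ i, G.Reachable b (a i) ∧ G.dist b (a i) = k i)
    (ℓ : Fin (n + 2) → Fin (n + 2) → ℕ)
    (hl : ∀ i j, i ≠ j → k i + k j = G.dist (a i) (a j) + 2 * ℓ i j)
    (ℓmin : ℕ)
    (hmin1 : ∀ i j, i < j → ℓmin ≤ ℓ i j)
    (hmin2 : ∃ i j, i < j ∧ ℓ i j = ℓmin)
    (c : V) (hcmem : c ∈ convClosure G (Set.range a)) (hcr : G.Reachable b c)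
    (hcnear : ∀ x ∈ convClosure G (Set.range a),
      G.Reachable b x → G.dist b c ≤ G.dist b x)
    (hcdist : G.dist b c = ℓmin)
    (m : ℕ) (hm : 2 ≤ m)
    (hdeg : {v | G.Adj c v ∧ v ∈ convClosure G (Set.range a)}.ncard = m) :
    ∃ s : Fin m → Fin (n + 2), Function.Injective s ∧
      (∀ i j : Fin m, i < j → ℓ (s i) (s j) = ℓmin) ∧
      (∀ t : Fin (n + 2), (∀ i, t ≠ s i) → a t ≠ c →
        ∃ i j : Fin m, Xor' (ℓ t (s i) = ℓmin) (ℓ t (s j) = ℓmin)) := by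
  have hca (i) : G.Reachable c (a i) := hcr.symm.trans (hb i).1
  have hk (i) : k i = ℓmin + G.dist c (a i) := by
    rw [← (hb i).2, ← hcdist]
    exact dist_eq_dist_add_dist_of_nearest hG hcmem hcr hcnear ⟨i, rfl⟩ (hca i)
  have min_of_ne {i j v w} (hv : IsFirstStep G c v (a i)) (hw : IsFirstStep G c w (a j))
      (hne : v ≠ w) : ℓ i j = ℓmin := by
    have hij : i ≠ j := by
      rintro rfl
      exact hne (hv.eq hG hw (hca i))
    have h₁ := hv.dist_add_dist_of_ne hG hw hne (hca i) (hca j)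
    have h₂ := hl i j hij
    have h₃ := hk i
    have h₄ := hk j
    omega
  have not_min {i j v} (hij : i ≠ j) (hi : IsFirstStep G c v (a i))
      (hj : IsFirstStep G c v (a j)) : ℓ i j ≠ ℓmin := by
    have h₁ := hi.dist_add_two_le hj (hca i)
    have h₂ := hl i j hij
    have h₃ := hk i
    have h₄ := hk j
    omega
  set N := {v | G.Adj c v ∧ v ∈ convClosure G (Set.range a)}
  have hfin : N.Finite := Set.finite_of_ncard_ne_zero (by omega)
  have : Finite N := hfin
  obtain ⟨e⟩ : Nonempty (Fin m ≃ N) :=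
    ⟨(Finite.equivFinOfCardEq ((Nat.card_coe_set_eq N).trans hdeg)).symm⟩
  have hstep (i : Fin m) : ∃ j, IsFirstStep G c (e i) (a j) := by
    obtain ⟨_, ⟨j, rfl⟩, hj⟩ := exists_isFirstStep_of_mem_convClosure hG (e i).2.1 (e i).2.2
    exact ⟨j, hj⟩
  choose s hs using hstep
  have e_ne {i j : Fin m} (h : i ≠ j) : (e i : V) ≠ e j :=
    fun h' ↦ h (e.injective (Subtype.ext h'))
  refine ⟨s, fun i j hij ↦ ?_, fun i j hij ↦ min_of_ne (hs i) (hs j) (e_ne hij.ne),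
    fun t ht htc ↦ ?_⟩
  · by_contra hne
    exact e_ne hne ((hs i).eq hG (hij ▸ hs j) (hca _))
  · obtain ⟨v, hv⟩ := exists_isFirstStep (hca t) (Ne.symm htc)
    obtain ⟨i, hi⟩ := e.surjective ⟨v, hv.1, hv.mem_convClosure hG hcmem ⟨t, rfl⟩ (hca t)⟩
    have hi' : (e i : V) = v := congrArg Subtype.val hi
    have : Nontrivial (Fin m) := Fin.nontrivial_iff_two_le.mpr hm
    obtain ⟨j, hj⟩ := exists_ne i
    refine ⟨j, i, Or.inl ⟨min_of_ne hv (hs j) (hi' ▸ (e_ne hj).symm), ?_⟩⟩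
    exact not_min (ht i) hv (hi' ▸ hs i)

end InfiniteBranchingTree
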